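/- arXiv:1807.01895 — 2 statements merged into one kernel-verified Lean document; each statement's English description precedes it below -/
import Mathlib

section
/- Let X be a Tychonoff space. If the space USC^f(X), endowed with the topology of pointwise convergence, is sequentially separable, then B₁(X), endowed with the topology of pointwise convergence, is sequentially separable. -/
open Filter Topology Set TopologicalSpace

universe u

/-- A zero-set: the preimage of `{0}` under some continuous real-valued function. -/
def IsZeroSet {X : Type u} [TopologicalSpace X] (Z : Set X) : Prop :=
  ∃ g : X → ℝ, Continuous g ∧ Z = g ⁻¹' {0}

/-- A cozero-set: the complement of a zero-set. -/
def IsCozeroSet {X : Type u} [TopologicalSpace X] (U : Set X) : Prop :=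
  IsZeroSet Uᶜ

/-- A Zσ-set: a countable union of zero-sets. -/
def IsZSigmaSet {X : Type u} [TopologicalSpace X] (D : Set X) : Prop :=
  ∃ Z : ℕ → Set X, (∀ n, IsZeroSet (Z n)) ∧ D = ⋃ n, Z n

/-- An Fσ-set: a countable union of closed sets. -/
def IsFSigmaSet {Y : Type u} [TopologicalSpace Y] (S : Set Y) : Prop :=
  ∃ F : ℕ → Set Y, (∀ n, IsClosed (F n)) ∧ S = ⋃ n, F n

/-- `g : ℕ → X → ℝ` converges pointwise to `f : X → ℝ`. -/
def PointwiseLimit {X : Type u} (g : ℕ → X → ℝ) (f : X → ℝ) : Prop :=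
  ∀ x, Tendsto (fun n => g n x) atTop (𝓝 (f x))

/-- `USC^f(X)`: real-valued functions all of whose strict sublevel sets are cozero-sets. -/
def USCf (X : Type u) [TopologicalSpace X] : Set (X → ℝ) :=
  {f | ∀ r : ℝ, IsCozeroSet {x | f x < r}}

/-- `USC(X)`: upper semicontinuous real-valued functions (strict sublevel sets open). -/
def USC (X : Type u) [TopologicalSpace X] : Set (X → ℝ) :=
  {f | ∀ r : ℝ, IsOpen {x | f x < r}}

/-- `B₁(X)`: Baire class one functions, i.e. pointwise limits of sequences of
continuous real-valued functions. -/
def B1 (X : Type u) [TopologicalSpace X] : Set (X → ℝ) :=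
  {f | ∃ g : ℕ → X → ℝ, (∀ n, Continuous (g n)) ∧ PointwiseLimit g f}

/-- A family `F` of real-valued functions on `X` is sequentially separable (for the
topology of pointwise convergence): there is a countable `S ⊆ F` such that every
member of `F` is a pointwise limit of a sequence from `S`. -/
def SeqSeparable {X : Type u} (F : Set (X → ℝ)) : Prop :=
  ∃ S : Set (X → ℝ), S ⊆ F ∧ S.Countable ∧
    ∀ f ∈ F, ∃ g : ℕ → X → ℝ, (∀ n, g n ∈ S) ∧ PointwiseLimit g f

/-- Property `U`: there is a continuous bijection (condensation) from `X` onto a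
separable metrizable space `Y` carrying every zero-set of `X` to an Fσ-set of `Y`. -/
def PropertyU (X : Type u) [TopologicalSpace X] : Prop :=
  ∃ (Y : Type u) (_ : TopologicalSpace Y), MetrizableSpace Y ∧ SeparableSpace Y ∧
    ∃ f : X → Y, Continuous f ∧ Function.Bijective f ∧
      ∀ D : Set X, IsZeroSet D → IsFSigmaSet (f '' D)

/-- The preimage of a closed subset of a metrizable space under a continuous map is a zero-set. -/
theorem isZeroSet_preimage_of_isClosed {X : Type u} [TopologicalSpace X] {M : Type*}
    [TopologicalSpace M] [MetrizableSpace M] {G : X → M} (hG : Continuous G) {C : Set M}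
    (hC : IsClosed C) : IsZeroSet (G ⁻¹' C) := by
  let := metrizableSpaceMetric M
  rcases C.eq_empty_or_nonempty with rfl | hne
  · exact ⟨fun _ => 1, continuous_const, by ext; simp⟩
  · refine ⟨fun x => Metric.infDist (G x) C, (Metric.continuous_infDist_pt C).comp hG, ?_⟩
    ext x
    exact hC.mem_iff_infDist_zero hne

/-- The indicator function of a zero-set belongs to `USC^f(X)`. -/
theorem IsZeroSet.indicator_mem_USCf {X : Type u} [TopologicalSpace X] {T : Set X}
    (hT : IsZeroSet T) : T.indicator (fun _ => (1 : ℝ)) ∈ USCf X := by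
  intro r
  unfold IsCozeroSet
  by_cases h1 : 1 < r
  · convert isZeroSet_preimage_of_isClosed (X := X)
      (continuous_const (y := (0 : ℝ))) isClosed_empty using 1
    ext x
    by_cases hx : x ∈ T <;> simp [hx] <;> linarith
  by_cases h0 : 0 < r
  · convert hT using 1
    ext x
    by_cases hx : x ∈ T <;> simp [hx] <;> linarith
  · convert isZeroSet_preimage_of_isClosed (X := X)
      (continuous_const (y := (0 : ℝ))) isClosed_univ using 1
    ext x
    by_cases hx : x ∈ T <;> simp [hx] <;> linarith

/-- The indicator function of a zero-set is a pointwise limit of continuous functions. -/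
theorem IsZeroSet.exists_tendsto_indicator {X : Type u} [TopologicalSpace X] {T : Set X}
    (hT : IsZeroSet T) : ∃ u : ℕ → X → ℝ, (∀ n, Continuous (u n)) ∧
      PointwiseLimit u (T.indicator (fun _ => (1 : ℝ))) := by
  obtain ⟨g, hg, rfl⟩ := hT
  refine ⟨fun n x => max 0 (1 - n * |g x|), fun n => by fun_prop, fun x => ?_⟩
  by_cases hx : g x = 0
  · simp [hx]
  · have hlim : Tendsto (fun n : ℕ => (n : ℝ) * |g x|) atTop atTop :=
      tendsto_natCast_atTop_atTop.atTop_mul_const (abs_pos.2 hx)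
    refine tendsto_const_nhds.congr' ?_
    filter_upwards [hlim.eventually_ge_atTop 1] with n hn
    simp only [indicator, mem_preimage, mem_singleton_iff, hx, if_false]
    exact (max_eq_left (by linarith)).symm

open Classical in
/-- The membership pattern of a point in the first `N` sets of a sequence. -/
noncomputable def membershipPattern {X : Type u} (A : ℕ → Set X) (N : ℕ) (x : X) :
    Fin N → Bool :=
  fun i => decide (x ∈ A i)

/-- A function of the memberships in finitely many zero-sets is of Baire class one. -/
theorem comp_membershipPattern_mem_B1 {X : Type u} [TopologicalSpace X] {A : ℕ → Set X}
    (hA : ∀ i, IsZeroSet (A i)) (N : ℕ) (F : (Fin N → Bool) → ℝ) :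
    (fun x => F (membershipPattern A N x)) ∈ B1 X := by
  choose u hu hlim using fun i => (hA i).exists_tendsto_indicator
  let e : (Fin N → Bool) → (Fin N → ℝ) := fun b i => if b i then 1 else 0
  have he : IsClosedEmbedding e := by
    refine (continuous_of_discreteTopology (f := e)).isClosedEmbedding fun b c hbc => ?_
    funext i
    have := congrFun hbc i
    cases hb : b i <;> cases hc : c i <;> simp [e, hb, hc] at this ⊢
  obtain ⟨E, hE⟩ := ContinuousMap.exists_extension' he
    (⟨F, continuous_of_discreteTopology⟩ : C(Fin N → Bool, ℝ))
  refine ⟨fun n x => E fun i : Fin N => u i n x, fun n => E.continuous.comp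
    (continuous_pi fun i : Fin N => hu i n), fun x => ?_⟩
  have hval : F (membershipPattern A N x) = E (e (membershipPattern A N x)) :=
    (congrFun hE _).symm
  beta_reduce
  rw [hval]
  refine (E.continuous.tendsto _).comp (tendsto_pi_nhds.2 fun i => ?_)
  convert hlim i x using 2
  by_cases hx : x ∈ A i <;> simp [e, membershipPattern, hx]

/-- Given a list of constraints `|r - q j| < ε j`, one rational satisfies every initial segment
of the constraints in force up to `n` that is satisfiable. -/
theorem exists_rat_satisfying_initial_constraints (q : ℕ → ℚ) (ε : ℕ → ℝ) (P : ℕ → Prop)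
    (n : ℕ) : ∃ r : ℚ, ∀ i ≤ n,
      (∃ r' : ℚ, ∀ j ≤ i, P j → |(r' : ℝ) - q j| < ε j) →
        ∀ j ≤ i, P j → |(r : ℝ) - q j| < ε j := by
  induction n with
  | zero =>
    by_cases h : ∃ r' : ℚ, ∀ j ≤ 0, P j → |(r' : ℝ) - q j| < ε j
    · obtain ⟨r', hr'⟩ := h
      exact ⟨r', fun i hi _ j hj => hr' j (hj.trans hi)⟩
    · refine ⟨0, fun i hi h' => ?_⟩
      obtain rfl : i = 0 := by omega
      exact absurd h' h
  | succ n ih =>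
    by_cases h : ∃ r' : ℚ, ∀ j ≤ n + 1, P j → |(r' : ℝ) - q j| < ε j
    · obtain ⟨r', hr'⟩ := h
      exact ⟨r', fun i hi _ j hj => hr' j (hj.trans hi)⟩
    · obtain ⟨r, hr⟩ := ih
      refine ⟨r, fun i hi h' => ?_⟩
      rcases hi.lt_or_eq with hlt | rfl
      · exact hr i (by omega) h'
      · exact absurd h' h

/-- Finitely many strict constraints satisfied by a real number are satisfied by a rational. -/
theorem exists_rat_satisfying_constraints (q : ℕ → ℚ) (ε : ℕ → ℝ) (P : ℕ → Prop) (i : ℕ) (y : ℝ)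
    (hy : ∀ j ≤ i, P j → |y - q j| < ε j) :
    ∃ r : ℚ, ∀ j ≤ i, P j → |(r : ℝ) - q j| < ε j := by
  have hopen : IsOpen {z : ℝ | ∀ j ∈ {j | j ≤ i}, P j → |z - q j| < ε j} := by
    simp only [ofPred_forall]
    refine (finite_le_nat i).isOpen_biInter fun j _ => isOpen_iInter_of_finite fun _ => ?_
    exact isOpen_lt (by fun_prop) continuous_const
  obtain ⟨_, hr, r, rfl⟩ := Rat.denseRange_cast.inter_open_nonempty _ hopen ⟨y, hy⟩
  exact ⟨r, hr⟩

/-- A Baire class one function is described by countably many zero-sets on which it is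
approximately constant. -/
theorem exists_zeroSet_approximation {X : Type u} [TopologicalSpace X] {f : X → ℝ}
    (hf : f ∈ B1 X) : ∃ (T : ℕ → Set X) (q : ℕ → ℚ) (ε : ℕ → ℝ), (∀ i, IsZeroSet (T i)) ∧
      (∀ i, ∀ x ∈ T i, |f x - q i| < ε i) ∧ ∀ x, ∀ δ > 0, ∃ i, x ∈ T i ∧ ε i < δ := by
  obtain ⟨g, hg, hlim⟩ := hf
  obtain ⟨d, hd⟩ := exists_surjective_nat (ℚ × ℕ × ℕ)
  let T : ℚ × ℕ × ℕ → Set X := fun p => {x | ∀ n ≥ p.2.2, |g n x - p.1| ≤ 1 / ((p.2.1 : ℝ) + 1)}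
  refine ⟨fun i => T (d i), fun i => (d i).1, fun i => 2 * (1 / (((d i).2.1 : ℝ) + 1)),
    fun i => ?_, fun i x hx => ?_, fun x δ hδ => ?_⟩
  · have hC : IsClosed {y : ℕ → ℝ | ∀ n ≥ (d i).2.2,
        |y n - (d i).1| ≤ 1 / (((d i).2.1 : ℝ) + 1)} := by
      simp only [ofPred_forall]
      exact isClosed_iInter fun n => isClosed_iInter fun _ =>
        isClosed_le (by fun_prop) continuous_const
    exact isZeroSet_preimage_of_isClosed (G := fun x n => g n x) (continuous_pi hg) hC
  · have hle : |f x - (d i).1| ≤ 1 / (((d i).2.1 : ℝ) + 1) :=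
      le_of_tendsto ((hlim x).sub_const _).abs (eventually_atTop.2 ⟨_, hx⟩)
    have hpos : (0 : ℝ) < 1 / (((d i).2.1 : ℝ) + 1) := by positivity
    linarith
  · obtain ⟨k, hk⟩ := exists_nat_one_div_lt (half_pos hδ)
    have hpos : (0 : ℝ) < 1 / ((k : ℝ) + 1) := by positivity
    obtain ⟨q, hq⟩ := exists_rat_near (f x) hpos
    obtain ⟨N, hN⟩ := eventually_atTop.1
      (((hlim x).sub_const (q : ℝ)).abs.eventually_lt_const hq)
    obtain ⟨i, hi⟩ := hd (q, k, N)
    refine ⟨i, ?_⟩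
    simp only [hi]
    exact ⟨fun n hn => (hN n hn).le, by linarith⟩

/-- If every zero-set is a pointwise limit of a sequence of sets chosen from a countable family,
then every Baire class one function is a pointwise limit of rational functions of finitely many
memberships in that family. -/
theorem exists_seq_comp_membershipPattern {X : Type u} [TopologicalSpace X] {A : ℕ → Set X}
    (hA : ∀ T : Set X, IsZeroSet T →
      ∃ a : ℕ → ℕ, ∀ x, ∀ᶠ n in atTop, (x ∈ A (a n) ↔ x ∈ T)) {f : X → ℝ} (hf : f ∈ B1 X) :
    ∃ (N : ℕ → ℕ) (F : ∀ n, (Fin (N n) → Bool) → ℚ),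
      PointwiseLimit (fun n x => (F n (membershipPattern A (N n) x) : ℝ)) f := by
  obtain ⟨T, q, ε, hT, hTf, hsmall⟩ := exists_zeroSet_approximation hf
  choose a ha using fun i => hA (T i) (hT i)
  choose Φ hΦ using fun n P => exists_rat_satisfying_initial_constraints q ε P n
  let N : ℕ → ℕ := fun n => (Finset.range (n + 1)).sup (fun j => a j n) + 1
  have hN : ∀ n, ∀ j ≤ n, a j n < N n := fun n j hj =>
    Nat.lt_succ_of_le (Finset.le_sup (f := fun j => a j n) (by simp; omega))
  let P : ∀ n, (Fin (N n) → Bool) → ℕ → Prop := fun n v j =>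
    ∃ hj : a j n < N n, v ⟨a j n, hj⟩ = true
  have hP : ∀ n x, ∀ j ≤ n, (P n (membershipPattern A (N n) x) j ↔ x ∈ A (a j n)) := by
    intro n x j hj
    simp [P, membershipPattern, hN n j hj]
  refine ⟨N, fun n v => Φ n (P n v), fun x => Metric.tendsto_nhds.2 fun δ hδ => ?_⟩
  obtain ⟨i, hxi, hi⟩ := hsmall x (δ / 2) (half_pos hδ)
  have hev : ∀ᶠ n in atTop, ∀ j ∈ {j | j ≤ i}, (x ∈ A (a j n) ↔ x ∈ T j) :=
    (eventually_all_finite (finite_le_nat i)).2 fun j _ => ha j x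
  filter_upwards [hev, eventually_ge_atTop i] with n hn hin
  have hPT : ∀ j ≤ i, (P n (membershipPattern A (N n) x) j ↔ x ∈ T j) := fun j hj =>
    (hP n x j (hj.trans hin)).trans (hn j hj)
  have hr := hΦ n (P n (membershipPattern A (N n) x)) i hin
    (exists_rat_satisfying_constraints q ε _ i (f x)
      fun j hj hPj => hTf j x ((hPT j hj).1 hPj)) i le_rfl ((hPT i le_rfl).2 hxi)
  have hf' := hTf i x hxi
  rw [Real.dist_eq]
  rw [abs_lt] at *
  constructor <;> linarith [hr.1, hr.2, hf'.1, hf'.2]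

/-- If `USC^f(X)` is sequentially separable for a Tychonoff space `X`, then so is `B₁(X)`. -/
theorem stmt5 (X : Type u) [TopologicalSpace X] [T2Space X] [CompletelyRegularSpace X]
    (h : SeqSeparable (USCf X)) : SeqSeparable (B1 X) := by
  obtain ⟨S, hSU, hSc, hS⟩ := h
  have hind : ∀ T : Set X, IsZeroSet T → ∃ g : ℕ → X → ℝ, (∀ n, g n ∈ S) ∧
      PointwiseLimit g (T.indicator fun _ => (1 : ℝ)) := fun T hT => hS _ hT.indicator_mem_USCf
  have hne : S.Nonempty := by
    obtain ⟨g, hg, _⟩ := hind univ ⟨fun _ => 0, continuous_const, by ext; simp⟩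
    exact ⟨g 0, hg 0⟩
  obtain ⟨s, rfl⟩ := hSc.exists_eq_range hne
  let A : ℕ → Set X := fun i => {x | s i x < 1 / 2}ᶜ
  have hAzero : ∀ i, IsZeroSet (A i) := fun i => hSU (mem_range_self i) (1 / 2)
  have hA : ∀ T : Set X, IsZeroSet T →
      ∃ a : ℕ → ℕ, ∀ x, ∀ᶠ n in atTop, (x ∈ A (a n) ↔ x ∈ T) := by
    intro T hT
    obtain ⟨g, hg, hlim⟩ := hind T hT
    choose a ha using hg
    refine ⟨a, fun x => ?_⟩
    have hx := hlim x
    by_cases hxT : x ∈ T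
    · rw [indicator_of_mem hxT] at hx
      filter_upwards [hx.eventually_const_lt (by norm_num : (1 / 2 : ℝ) < 1)] with n hn
      simpa only [A, ha, hxT, mem_compl_iff, mem_ofPred_eq, not_lt, iff_true] using hn.le
    · rw [indicator_of_notMem hxT] at hx
      filter_upwards [hx.eventually_lt_const (by norm_num : (0 : ℝ) < 1 / 2)] with n hn
      simpa only [A, ha, hxT, mem_compl_iff, mem_ofPred_eq, not_not, iff_false] using hn
  refine ⟨range fun p : Σ N : ℕ, (Fin N → Bool) → ℚ =>
    fun x => (p.2 (membershipPattern A p.1 x) : ℝ), ?_, countable_range _, fun f hf => ?_⟩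
  · rintro _ ⟨⟨N, F⟩, rfl⟩
    exact comp_membershipPattern_mem_B1 hAzero N fun v => (F v : ℝ)
  · obtain ⟨N, F, hlim⟩ := exists_seq_comp_membershipPattern hA hf
    exact ⟨_, fun n => ⟨⟨N n, F n⟩, rfl⟩, hlim⟩
end

section
/- Let X be a perfectly normal (Tychonoff) space. Then the following are equivalent: (1) the space USC(X) of all upper semicontinuous real-valued functions on X, endowed with the topology of pointwise convergence, is sequentially separable; (2) X has property U; (3) there exists a countable set S of continuous real-valued functions on X such that every function in B₁(X) is the pointwise limit of a sequence of elements of S. -/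
open Filter Topology Set TopologicalSpace

universe u

/-! ### Fσ-sets -/

theorem isFSigmaSet_iff_isGδ_compl {Y : Type u} [TopologicalSpace Y] {A : Set Y} :
    IsFSigmaSet A ↔ IsGδ Aᶜ := by
  rw [isGδ_iff_eq_iInter_nat]
  constructor
  · rintro ⟨F, hF, rfl⟩
    exact ⟨fun n => (F n)ᶜ, fun n => (hF n).isOpen_compl, by simp⟩
  · rintro ⟨G, hG, hA⟩
    exact ⟨fun n => (G n)ᶜ, fun n => (hG n).isClosed_compl, by
      rw [← compl_compl A, hA, compl_iInter]⟩

theorem IsClosed.isFSigmaSet {Y : Type u} [TopologicalSpace Y] {A : Set Y} (hA : IsClosed A) :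
    IsFSigmaSet A :=
  ⟨fun _ => A, fun _ => hA, (iUnion_const A).symm⟩

theorem IsFSigmaSet.iUnion {Y : Type u} [TopologicalSpace Y] {ι : Type*} [Countable ι]
    {A : ι → Set Y} (hA : ∀ i, IsFSigmaSet (A i)) : IsFSigmaSet (⋃ i, A i) := by
  simp only [isFSigmaSet_iff_isGδ_compl] at *
  rw [compl_iUnion]
  exact .iInter hA

theorem IsFSigmaSet.union {Y : Type u} [TopologicalSpace Y] {A B : Set Y}
    (hA : IsFSigmaSet A) (hB : IsFSigmaSet B) : IsFSigmaSet (A ∪ B) := by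
  simp only [isFSigmaSet_iff_isGδ_compl] at *
  rw [compl_union]
  exact hA.inter hB

theorem IsFSigmaSet.inter {Y : Type u} [TopologicalSpace Y] {A B : Set Y}
    (hA : IsFSigmaSet A) (hB : IsFSigmaSet B) : IsFSigmaSet (A ∩ B) := by
  simp only [isFSigmaSet_iff_isGδ_compl] at *
  rw [compl_inter]
  exact hA.union hB

theorem IsOpen.isFSigmaSet {Y : Type u} [TopologicalSpace Y] [PerfectlyNormalSpace Y]
    {A : Set Y} (hA : IsOpen A) : IsFSigmaSet A :=
  isFSigmaSet_iff_isGδ_compl.2 hA.isClosed_compl.isGδ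

/-- A real-valued function is Fσ-measurable if the preimages of open rays are Fσ-sets. -/
def FSigmaMeasurable {Y : Type u} [TopologicalSpace Y] (φ : Y → ℝ) : Prop :=
  ∀ r : ℝ, IsFSigmaSet {y | φ y < r} ∧ IsFSigmaSet {y | r < φ y}

theorem isFSigmaSet_lt_of_pointwiseLimit {Y : Type u} [TopologicalSpace Y] {g : ℕ → Y → ℝ}
    {φ : Y → ℝ} (hg : ∀ n, Continuous (g n)) (h : PointwiseLimit g φ) (r : ℝ) :
    IsFSigmaSet {y | r < φ y} := by
  have key : {y | r < φ y} =
      ⋃ k : ℕ, ⋃ N : ℕ, ⋂ n : ℕ, ⋂ _ : N ≤ n, {y | r + 1 / ((k : ℝ) + 1) ≤ g n y} := by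
    ext y
    simp only [mem_ofPred_eq, mem_iUnion, mem_iInter]
    constructor
    · intro hy
      obtain ⟨k, hk⟩ := exists_nat_one_div_lt (sub_pos.2 hy)
      obtain ⟨N, hN⟩ := eventually_atTop.1 ((h y).eventually_const_lt
        (show r + 1 / ((k : ℝ) + 1) < φ y by linarith))
      exact ⟨k, N, fun n hn => (hN n hn).le⟩
    · rintro ⟨k, N, hN⟩
      have h1 : r + 1 / ((k : ℝ) + 1) ≤ φ y :=
        ge_of_tendsto (h y) (eventually_atTop.2 ⟨N, hN⟩)
      have h2 : (0 : ℝ) < 1 / ((k : ℝ) + 1) := Nat.one_div_pos_of_nat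
      linarith
  rw [key]
  exact .iUnion fun k => .iUnion fun N => (isClosed_iInter fun n => isClosed_iInter fun _ =>
    isClosed_le continuous_const (hg n)).isFSigmaSet

theorem fSigmaMeasurable_of_pointwiseLimit {Y : Type u} [TopologicalSpace Y] {g : ℕ → Y → ℝ}
    {φ : Y → ℝ} (hg : ∀ n, Continuous (g n)) (h : PointwiseLimit g φ) :
    FSigmaMeasurable φ := by
  refine fun r => ⟨?_, isFSigmaSet_lt_of_pointwiseLimit hg h r⟩
  have := isFSigmaSet_lt_of_pointwiseLimit (g := fun n y => -g n y) (φ := fun y => -φ y)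
    (fun n => (hg n).neg) (fun y => (h y).neg) (-r)
  simpa using this

theorem FSigmaMeasurable.isFSigmaSet_preimage {Y : Type u} [TopologicalSpace Y] {φ : Y → ℝ}
    (hφ : FSigmaMeasurable φ) {V : Set ℝ} (hV : IsOpen V) : IsFSigmaSet (φ ⁻¹' V) := by
  obtain ⟨B, hB, rfl⟩ := Real.isTopologicalBasis_Ioo_rat.open_eq_sUnion hV
  have : Countable B := ((countable_iUnion fun a : ℚ => countable_iUnion fun b : ℚ =>
    countable_iUnion fun _ : a < b => countable_singleton _).mono hB).to_subtype
  rw [sUnion_eq_iUnion, preimage_iUnion]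
  refine .iUnion fun I => ?_
  obtain ⟨a, b, -, hI⟩ : ∃ a b : ℚ, a < b ∧ (I : Set ℝ) = Ioo (a : ℝ) b := by
    simpa using hB I.2
  rw [hI]
  exact (hφ a).2.inter (hφ b).1

theorem FSigmaMeasurable.continuous_comp {Y : Type u} [TopologicalSpace Y] {φ : Y → ℝ}
    (hφ : FSigmaMeasurable φ) {θ : ℝ → ℝ} (hθ : Continuous θ) :
    FSigmaMeasurable fun y => θ (φ y) :=
  fun r => ⟨hφ.isFSigmaSet_preimage ((isOpen_Iio (a := r)).preimage hθ),
    hφ.isFSigmaSet_preimage ((isOpen_Ioi (a := r)).preimage hθ)⟩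

/-! ### Approximating Fσ-measurable functions -/

/-- Every closed set has an indicator which is pointwise the eventual value of a sequence of
`[0, 1]`-valued members of `A`. -/
def ApproximatesClosed {Y : Type u} [TopologicalSpace Y] (A : Subalgebra ℚ (Y → ℝ)) : Prop :=
  ∀ F : Set Y, IsClosed F → ∃ α : ℕ → Y → ℝ, (∀ n, α n ∈ A) ∧ (∀ n y, α n y ∈ Icc (0 : ℝ) 1) ∧
    (∀ y ∈ F, ∀ᶠ n in atTop, α n y = 1) ∧ ∀ y ∉ F, ∀ᶠ n in atTop, α n y = 0

theorem exists_countable_urysohn_family (Y : Type u) [TopologicalSpace Y] [NormalSpace Y]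
    [T1Space Y] [SecondCountableTopology Y] :
    ∃ U : Set (Y → ℝ), U.Countable ∧ (∀ u ∈ U, Continuous u ∧ ∀ y, u y ∈ Icc (0 : ℝ) 1) ∧
      ∀ F : Set Y, IsClosed F → ∀ y ∉ F, ∃ u ∈ U, (∀ z ∈ F, u z = 0) ∧ u y = 1 := by
  have hu : ∀ p : {p : countableBasis Y × countableBasis Y //
      closure (p.1 : Set Y) ⊆ (p.2 : Set Y)}, ∃ f : C(Y, ℝ),
      EqOn f 0 (p.1.2 : Set Y)ᶜ ∧ EqOn f 1 (closure (p.1.1 : Set Y)) ∧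
        ∀ x, f x ∈ Icc (0 : ℝ) 1 := fun p =>
    exists_continuous_zero_one_of_isClosed
      (isOpen_of_mem_countableBasis p.1.2.2).isClosed_compl isClosed_closure
      (disjoint_compl_left_iff_subset.2 p.2)
  choose f hf0 hf1 hf using hu
  refine ⟨range fun p => (f p : Y → ℝ), countable_range _, ?_, ?_⟩
  · rintro _ ⟨p, rfl⟩
    exact ⟨(f p).continuous, hf p⟩
  · intro F hF y hy
    obtain ⟨V, hV, hyV, hVF⟩ := (isBasis_countableBasis Y).exists_subset_of_mem_open
      (show y ∈ Fᶜ from hy) hF.isOpen_compl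
    obtain ⟨W, hW, hyW, hWV⟩ := (isBasis_countableBasis Y).exists_closure_subset
      ((isOpen_of_mem_countableBasis hV).mem_nhds hyV)
    refine ⟨_, ⟨⟨(⟨W, hW⟩, ⟨V, hV⟩), hWV⟩, rfl⟩, fun z hz => ?_, ?_⟩
    · exact hf0 _ fun hzV => hVF hzV hz
    · exact hf1 _ (subset_closure hyW)

theorem exists_countable_approximatesClosed (Y : Type u) [TopologicalSpace Y] [NormalSpace Y]
    [T1Space Y] [SecondCountableTopology Y] :
    ∃ A : Subalgebra ℚ (Y → ℝ), (A : Set (Y → ℝ)).Countable ∧ (∀ g ∈ A, Continuous g) ∧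
      ApproximatesClosed A := by
  obtain ⟨U, hUc, hU, hUF⟩ := exists_countable_urysohn_family Y
  refine ⟨Algebra.adjoin ℚ U, ?_, ?_, ?_⟩
  · have : Countable U := hUc
    rw [Algebra.adjoin_eq_range, AlgHom.coe_range]
    have : Countable (MvPolynomial U ℚ) := by
      rw [← Cardinal.mk_le_aleph0_iff]
      exact MvPolynomial.cardinalMk_le_max_lift.trans (by simp)
    exact countable_range _
  · intro g hg
    induction hg using Algebra.adjoin_induction with
    | mem x hx => exact (hU x hx).1
    | algebraMap r => exact continuous_const
    | add x y _ _ hx hy => exact hx.add hy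
    | mul x y _ _ hx hy => exact hx.mul hy
  · intro F hF
    obtain ⟨u, hu⟩ := (show (insert 0 {u | u ∈ U ∧ ∀ z ∈ F, u z = 0} : Set (Y → ℝ)).Countable from
      (hUc.mono fun _ h => h.1).insert 0).exists_eq_range (insert_nonempty _ _)
    have hmem : ∀ k, u k = 0 ∨ (u k ∈ U ∧ ∀ z ∈ F, u k z = 0) := fun k => by
      have := mem_range_self (f := u) k
      rwa [← hu] at this
    have hA : ∀ k, u k ∈ Algebra.adjoin ℚ U := fun k => by
      rcases hmem k with h | h
      · rw [h]; exact zero_mem _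
      · exact Algebra.subset_adjoin h.1
    have hI : ∀ k y, u k y ∈ Icc (0 : ℝ) 1 := fun k y => by
      rcases hmem k with h | h
      · simp [h]
      · exact (hU _ h.1).2 y
    have hI' : ∀ k y, 0 ≤ 1 - u k y ∧ 1 - u k y ≤ 1 := fun k y =>
      ⟨sub_nonneg.2 (hI k y).2, sub_le_self _ (hI k y).1⟩
    refine ⟨fun n => ∏ k ∈ Finset.range n, (1 - u k), fun n => ?_, fun n y => ?_, fun y hy => ?_,
      fun y hy => ?_⟩
    · exact prod_mem fun k _ => sub_mem (one_mem _) (hA k)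
    · simp only [Finset.prod_apply, Pi.sub_apply, Pi.one_apply]
      exact ⟨Finset.prod_nonneg fun k _ => (hI' k y).1,
        Finset.prod_le_one (fun k _ => (hI' k y).1) fun k _ => (hI' k y).2⟩
    · refine Eventually.of_forall fun n => ?_
      simp only [Finset.prod_apply, Pi.sub_apply, Pi.one_apply]
      refine Finset.prod_eq_one fun k _ => ?_
      rcases hmem k with h | h
      · simp [h]
      · simp [h.2 y hy]
    · obtain ⟨v, hvU, hvF, hvy⟩ := hUF F hF y hy
      obtain ⟨k, rfl⟩ : v ∈ range u := hu ▸ Or.inr ⟨hvU, hvF⟩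
      filter_upwards [eventually_gt_atTop k] with n hn
      simp only [Finset.prod_apply, Pi.sub_apply, Pi.one_apply]
      exact Finset.prod_eq_zero (Finset.mem_range.2 hn) (by simp [hvy])

/-- Reduction: two Fσ-sets covering the space can be shrunk to a partition whose indicator is the
eventual value of a sequence from `A`. -/
theorem ApproximatesClosed.exists_reduction {Y : Type u} [TopologicalSpace Y]
    {A : Subalgebra ℚ (Y → ℝ)} (hA : ApproximatesClosed A) {P Q : Set Y}
    (hP : IsFSigmaSet P) (hQ : IsFSigmaSet Q) (hPQ : ∀ y, y ∈ P ∨ y ∈ Q) :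
    ∃ (h : ℕ → Y → ℝ) (a : Y → ℝ), (∀ n, h n ∈ A) ∧ (∀ n y, h n y ∈ Icc (0 : ℝ) 1) ∧
      (∀ y, a y = 1 ∧ y ∈ P ∨ a y = 0 ∧ y ∈ Q) ∧ PointwiseLimit h a := by
  classical
  obtain ⟨F, hF, rfl⟩ := hP
  obtain ⟨G, hG, rfl⟩ := hQ
  choose α hαA hαI hα1 hα0 using fun j => hA (F j) (hF j)
  choose β hβA hβI hβ1 hβ0 using fun j => hA (G j) (hG j)
  have hex : ∀ y, ∃ j, y ∈ F j ∨ y ∈ G j := fun y => by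
    rcases hPQ y with h | h <;> obtain ⟨j, hj⟩ := mem_iUnion.1 h
    exacts [⟨j, .inl hj⟩, ⟨j, .inr hj⟩]
  let p : Y → ℕ := fun y => Nat.find (hex y)
  have hp : ∀ y, y ∈ F (p y) ∨ y ∈ G (p y) := fun y => Nat.find_spec (hex y)
  have hlt : ∀ y, ∀ i < p y, y ∉ F i ∧ y ∉ G i := fun y i hi => not_or.1 (Nat.find_min (hex y) hi)
  let w : ℕ → ℕ → Y → ℝ := fun n j => ∏ i ∈ Finset.range j, ((1 - α i n) * (1 - β i n))
  have hw0 : ∀ n j y, 0 ≤ w n j y := fun n j y => by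
    simp only [w, Finset.prod_apply, Pi.sub_apply, Pi.one_apply, Pi.mul_apply]
    exact Finset.prod_nonneg fun i _ => mul_nonneg (sub_nonneg.2 (hαI i n y).2)
      (sub_nonneg.2 (hβI i n y).2)
  have hsum : ∀ n N y, (∑ j ∈ Finset.range N, α j n * w n j) y + w n N y ≤ 1 := by
    intro n N y
    induction N with
    | zero => simp [w]
    | succ N ih =>
      have hs : w n (N + 1) y = w n N y * ((1 - α N n y) * (1 - β N n y)) := by
        simp [w, Finset.prod_range_succ]
      rw [Finset.sum_range_succ, Pi.add_apply, Pi.mul_apply, hs]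
      have h1 := mul_nonneg (hw0 n N y) (mul_nonneg (sub_nonneg.2 (hαI N n y).2) (hβI N n y).1)
      nlinarith
  refine ⟨fun n => ∑ j ∈ Finset.range n, α j n * w n j, fun y => if y ∈ F (p y) then 1 else 0,
    fun n => ?_, fun n y => ⟨?_, ?_⟩, fun y => ?_, fun y => ?_⟩
  · exact sum_mem fun j _ => mul_mem (hαA j n) (prod_mem fun i _ =>
      mul_mem (sub_mem (one_mem _) (hαA i n)) (sub_mem (one_mem _) (hβA i n)))
  · simp only [Finset.sum_apply, Pi.mul_apply]
    exact Finset.sum_nonneg fun j _ => mul_nonneg (hαI j n y).1 (hw0 n j y)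
  · linarith [hsum n n y, hw0 n n y]
  · by_cases h : y ∈ F (p y)
    · exact .inl ⟨if_pos h, mem_iUnion.2 ⟨_, h⟩⟩
    · exact .inr ⟨if_neg h, mem_iUnion.2 ⟨_, (hp y).resolve_left h⟩⟩
  · have hlow : ∀ᶠ n in atTop, ∀ i ∈ Finset.range (p y), α i n y = 0 ∧ β i n y = 0 := by
      rw [Filter.eventually_all_finset]
      intro i hi
      have := hlt y i (Finset.mem_range.1 hi)
      exact (hα0 i y this.1).and (hβ0 i y this.2)
    have hpt : ∀ᶠ n in atTop, α (p y) n y = (if y ∈ F (p y) then 1 else 0) ∧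
        (1 - α (p y) n y) * (1 - β (p y) n y) = 0 := by
      by_cases h : y ∈ F (p y)
      · filter_upwards [hα1 _ y h] with n hn
        simp [h, hn]
      · filter_upwards [hα0 _ y h, hβ1 _ y ((hp y).resolve_left h)] with n hn hn'
        simp [h, hn, hn']
    refine tendsto_const_nhds.congr' ?_
    filter_upwards [hlow, hpt, eventually_gt_atTop (p y)] with n h1 h2 h3
    have hwp : w n (p y) y = 1 := by
      simp only [w, Finset.prod_apply, Pi.sub_apply, Pi.one_apply, Pi.mul_apply]
      exact Finset.prod_eq_one fun i hi => by simp [h1 i hi]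
    simp only [Finset.sum_apply, Pi.mul_apply]
    rw [Finset.sum_eq_single (p y), hwp, mul_one, h2.1]
    · intro j _ hj
      rcases lt_or_gt_of_ne hj with hj | hj
      · rw [(h1 j (Finset.mem_range.2 hj)).1, zero_mul]
      · simp only [w, Finset.prod_apply, Pi.sub_apply, Pi.one_apply, Pi.mul_apply]
        rw [Finset.prod_eq_zero (Finset.mem_range.2 hj) h2.2, mul_zero]
    · exact fun h => (h (Finset.mem_range.2 h3)).elim

/-- One step of the expansion `φ = a / 3 + 2 φ' / 3` of an Fσ-measurable function. -/
theorem ApproximatesClosed.exists_step {Y : Type u} [TopologicalSpace Y]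
    {A : Subalgebra ℚ (Y → ℝ)} (hA : ApproximatesClosed A) (hAc : ∀ g ∈ A, Continuous g)
    {φ : Y → ℝ} (hφ : FSigmaMeasurable φ) (hI : ∀ y, φ y ∈ Icc (0 : ℝ) 1) :
    ∃ (h : ℕ → Y → ℝ) (a φ' : Y → ℝ), (∀ n, h n ∈ A) ∧ (∀ n y, h n y ∈ Icc (0 : ℝ) 1) ∧
      PointwiseLimit h a ∧ FSigmaMeasurable φ' ∧ (∀ y, φ' y ∈ Icc (0 : ℝ) 1) ∧
      ∀ y, φ y = 1 / 3 * a y + 2 / 3 * φ' y := by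
  obtain ⟨h, a, hh, hhI, ha, hlim⟩ := hA.exists_reduction (hφ (1 / 3)).2 (hφ (2 / 3)).1
    fun y => (lt_or_ge (1 / 3 : ℝ) (φ y)).imp id fun hy => by
      simp only [mem_ofPred_eq]; linarith
  have ham := fSigmaMeasurable_of_pointwiseLimit (fun n => hAc _ (hh n)) hlim
  refine ⟨h, a, fun y => 3 / 2 * φ y - 1 / 2 * a y, hh, hhI, hlim, fun r => ⟨?_, ?_⟩,
    fun y => ?_, fun y => by ring⟩
  · convert ((hφ (2 / 3 * r + 1 / 3)).1.inter (ham (1 / 2)).2).union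
      ((hφ (2 / 3 * r)).1.inter (ham (1 / 2)).1) using 1
    ext y
    rcases ha y with ⟨h1, -⟩ | ⟨h1, -⟩ <;>
      simp only [mem_ofPred_eq, mem_union, mem_inter_iff, h1] <;> norm_num <;>
      constructor <;> intro h <;> linarith
  · convert ((hφ (2 / 3 * r + 1 / 3)).2.inter (ham (1 / 2)).2).union
      ((hφ (2 / 3 * r)).2.inter (ham (1 / 2)).1) using 1
    ext y
    rcases ha y with ⟨h1, -⟩ | ⟨h1, -⟩ <;>
      simp only [mem_ofPred_eq, mem_union, mem_inter_iff, h1] <;> norm_num <;>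
      constructor <;> intro h <;> linarith
  · have := hI y
    rcases ha y with ⟨h1, h2⟩ | ⟨h1, h2⟩ <;> simp only [mem_ofPred_eq] at h2 <;>
      simp only [h1, mem_Icc] at this ⊢ <;> constructor <;> linarith

theorem ApproximatesClosed.exists_pointwiseLimit_of_mem_Icc {Y : Type u} [TopologicalSpace Y]
    {A : Subalgebra ℚ (Y → ℝ)} (hA : ApproximatesClosed A) (hAc : ∀ g ∈ A, Continuous g)
    {φ : Y → ℝ} (hφ : FSigmaMeasurable φ) (hI : ∀ y, φ y ∈ Icc (0 : ℝ) 1) :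
    ∃ g : ℕ → Y → ℝ, (∀ n, g n ∈ A) ∧ PointwiseLimit g φ := by
  choose h a φ' hh hhI hlim hφ' hI' hdecomp using
    fun ψ : {ψ : Y → ℝ // FSigmaMeasurable ψ ∧ ∀ y, ψ y ∈ Icc (0 : ℝ) 1} =>
      hA.exists_step hAc ψ.2.1 ψ.2.2
  let Φ : ℕ → {ψ : Y → ℝ // FSigmaMeasurable ψ ∧ ∀ y, ψ y ∈ Icc (0 : ℝ) 1} := fun k =>
    (fun ψ => ⟨φ' ψ, hφ' ψ, hI' ψ⟩)^[k] ⟨φ, hφ, hI⟩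
  have hΦ : ∀ k, (Φ (k + 1) : Y → ℝ) = φ' (Φ k) := fun k => by
    simp only [Φ, Function.iterate_succ_apply']
  let c : ℕ → ℝ := fun k => 1 / 3 * (2 / 3) ^ k
  have hc0 : ∀ k, 0 ≤ c k := fun k => by positivity
  have hc : Summable c := (summable_geometric_of_lt_one (by norm_num) (by norm_num)).mul_left _
  have hpartial : ∀ y K, ∑ k ∈ Finset.range K, c k * a (Φ k) y =
      φ y - (2 / 3) ^ K * (Φ K : Y → ℝ) y := by
    intro y K
    induction K with
    | zero => simp [Φ]
    | succ K ih =>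
      rw [Finset.sum_range_succ, ih, hΦ, hdecomp (Φ K) y]
      simp only [c]
      ring
  have haI : ∀ k y, a k y ∈ Icc (0 : ℝ) 1 := fun k y =>
    isClosed_Icc.mem_of_tendsto (hlim k y) (Eventually.of_forall fun n => hhI k n y)
  have hbound : ∀ k t, t ∈ Icc (0 : ℝ) 1 → ‖c k * t‖ ≤ c k := fun k t ht => by
    rw [Real.norm_eq_abs, abs_of_nonneg (mul_nonneg (hc0 k) ht.1)]
    exact mul_le_of_le_one_right (hc0 k) ht.2
  have htsum : ∀ y, ∑' k, c k * a (Φ k) y = φ y := by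
    intro y
    have hs : Summable fun k => c k * a (Φ k) y :=
      .of_norm_bounded hc fun k => hbound k _ (haI _ y)
    refine tendsto_nhds_unique hs.hasSum.tendsto_sum_nat ?_
    simp only [hpartial]
    have : Tendsto (fun K => (2 / 3 : ℝ) ^ K * (Φ K : Y → ℝ) y) atTop (𝓝 0) := by
      refine squeeze_zero (fun K => mul_nonneg (by positivity) ((Φ K).2.2 y).1)
        (fun K => mul_le_of_le_one_right (by positivity) ((Φ K).2.2 y).2)
        (tendsto_pow_atTop_nhds_zero_of_lt_one (by norm_num) (by norm_num))
    simpa using tendsto_const_nhds.sub this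
  refine ⟨fun n => ∑ k ∈ Finset.range n, (1 / 3 * (2 / 3) ^ k : ℚ) • h (Φ k) n, fun n =>
    sum_mem fun k _ => A.smul_mem (hh _ _) _, fun y => ?_⟩
  have hfin : ∀ n, (∑ k ∈ Finset.range n, (1 / 3 * (2 / 3) ^ k : ℚ) • h (Φ k) n) y =
      ∑' k, if k < n then c k * h (Φ k) n y else 0 := by
    intro n
    rw [tsum_eq_sum (s := Finset.range n) fun k hk => if_neg (by simpa using hk),
      Finset.sum_apply]
    refine Finset.sum_congr rfl fun k hk => ?_
    rw [if_pos (Finset.mem_range.1 hk), Pi.smul_apply, Rat.smul_def]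
    push_cast
    rfl
  simp only [hfin, ← htsum y]
  refine tendsto_tsum_of_dominated_convergence hc (fun k => ?_) (Eventually.of_forall fun n k => ?_)
  · refine ((hlim (Φ k) y).const_mul (c k)).congr' ?_
    filter_upwards [eventually_gt_atTop k] with n hn
    rw [if_pos hn]
  · split_ifs
    · exact hbound k _ (hhI _ _ y)
    · simpa using hc0 k

/-- On a second countable metrizable space there is a countable set of continuous functions whose
sequential limits are all the Fσ-measurable functions. -/
theorem exists_countable_continuous_dense_fSigmaMeasurable (Y : Type u) [TopologicalSpace Y]
    [NormalSpace Y] [T1Space Y] [SecondCountableTopology Y] :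
    ∃ S : Set (Y → ℝ), S.Countable ∧ (∀ g ∈ S, Continuous g) ∧
      ∀ φ, FSigmaMeasurable φ → ∃ g : ℕ → Y → ℝ, (∀ n, g n ∈ S) ∧ PointwiseLimit g φ := by
  obtain ⟨A, hAcount, hAc, hA⟩ := exists_countable_approximatesClosed Y
  let T : ℕ → ℝ → ℝ := fun n t => (2 * t - 1) / max (1 / ((n : ℝ) + 1)) (1 - |2 * t - 1|)
  have hpos : ∀ (n : ℕ) (t : ℝ), 0 < max (1 / ((n : ℝ) + 1)) (1 - |2 * t - 1|) := fun n t =>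
    lt_max_of_lt_left Nat.one_div_pos_of_nat
  have hT : ∀ n, Continuous (T n) := fun n =>
    Continuous.div (by fun_prop) (by fun_prop) fun t => (hpos n t).ne'
  refine ⟨⋃ n, (fun g : Y → ℝ => T n ∘ g) '' A, countable_iUnion fun n => hAcount.image _, ?_, ?_⟩
  · simp only [mem_iUnion]
    rintro _ ⟨n, g, hg, rfl⟩
    exact (hT n).comp (hAc g hg)
  · intro φ hφ
    have hθ : Continuous fun t : ℝ => (1 + t / (1 + |t|)) / 2 :=
      (continuous_const.add (continuous_id.div (by fun_prop) fun t => by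
        positivity)).div_const 2
    have habs : ∀ y, 0 < 1 + |φ y| := fun y => by positivity
    have hle : ∀ y, |φ y / (1 + |φ y|)| = |φ y| / (1 + |φ y|) := fun y => by
      rw [abs_div, abs_of_pos (habs y)]
    have hlt : ∀ y, |φ y / (1 + |φ y|)| < 1 := fun y => by
      rw [hle, div_lt_one (habs y)]
      linarith
    obtain ⟨g, hg, hlim⟩ := hA.exists_pointwiseLimit_of_mem_Icc hAc (hφ.continuous_comp hθ) fun y => by
      have := abs_lt.1 (hlt y)
      constructor <;> linarith
    refine ⟨fun n => T n ∘ g n, fun n => mem_iUnion.2 ⟨n, g n, hg n, rfl⟩, fun y => ?_⟩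
    have h1 : Tendsto (fun n => 2 * g n y - 1) atTop (𝓝 (φ y / (1 + |φ y|))) := by
      convert ((hlim y).const_mul 2).sub_const 1 using 2
      ring
    have h2 : Tendsto (fun n : ℕ => max (1 / ((n : ℝ) + 1)) (1 - |2 * g n y - 1|)) atTop
        (𝓝 (1 - |φ y / (1 + |φ y|)|)) := by
      convert tendsto_one_div_add_atTop_nhds_zero_nat.max (h1.abs.const_sub 1) using 2
      exact (max_eq_right (sub_nonneg.2 (hlt y).le)).symm
    have h3 : φ y / (1 + |φ y|) / (1 - |φ y / (1 + |φ y|)|) = φ y := by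
      rw [hle, one_sub_div (habs y).ne', add_sub_cancel_right,
        div_div_div_cancel_right₀ (habs y).ne', div_one]
    have h4 := h1.div h2 (sub_pos.2 (hlt y)).ne'
    rwa [h3] at h4

/-! ### Property `U` -/

theorem IsClosed.isZeroSet {X : Type u} [TopologicalSpace X] [PerfectlyNormalSpace X]
    {D : Set X} (hD : IsClosed D) : IsZeroSet D := by
  obtain ⟨g, hg, -⟩ := perfectlyNormalSpace_iff_forall_isClosed_preimage_zero.1 ‹_› D hD
  exact ⟨g, g.continuous, hg⟩

theorem Continuous.mem_USC {X : Type u} [TopologicalSpace X] {g : X → ℝ} (hg : Continuous g) :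
    g ∈ USC X :=
  fun _ => isOpen_lt hg continuous_const

theorem PropertyU.exists_countable_continuous {X : Type u} [TopologicalSpace X]
    [PerfectlyNormalSpace X] (hX : PropertyU X) :
    ∃ S : Set (X → ℝ), S.Countable ∧ (∀ g ∈ S, Continuous g) ∧
      ∀ φ, FSigmaMeasurable φ → ∃ g : ℕ → X → ℝ, (∀ n, g n ∈ S) ∧ PointwiseLimit g φ := by
  obtain ⟨Y, _, _, _, f, hfc, hfb, hf⟩ := hX
  let _ := metrizableSpaceMetric Y
  have : SecondCountableTopology Y := UniformSpace.secondCountable_of_separable Y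
  obtain ⟨S, hS, hSc, hSlim⟩ := exists_countable_continuous_dense_fSigmaMeasurable Y
  have himage : ∀ E : Set X, IsFSigmaSet E → IsFSigmaSet (f '' E) := by
    rintro _ ⟨F, hF, rfl⟩
    rw [image_iUnion]
    exact .iUnion fun n => hf _ (hF n).isZeroSet
  refine ⟨(fun g : Y → ℝ => g ∘ f) '' S, hS.image _, ?_, fun φ hφ => ?_⟩
  · rintro _ ⟨g, hg, rfl⟩
    exact (hSc g hg).comp hfc
  · let e : X ≃ Y := Equiv.ofBijective f hfb
    have hpre : ∀ E : Set X, f '' E = e.symm ⁻¹' E := e.image_eq_preimage_symm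
    obtain ⟨g, hg, hlim⟩ := hSlim (φ ∘ e.symm) fun r =>
      ⟨(hpre _).subst (motive := IsFSigmaSet) (himage _ (hφ r).1),
        (hpre _).subst (motive := IsFSigmaSet) (himage _ (hφ r).2)⟩
    refine ⟨fun n => g n ∘ f, fun n => mem_image_of_mem _ (hg n), fun x => ?_⟩
    have := hlim (f x)
    rwa [Function.comp_apply, show e.symm (f x) = x from e.symm_apply_apply x] at this

theorem propertyU_of_indicator_limits {X : Type u} [TopologicalSpace X] [T1Space X]
    [PerfectlyNormalSpace X] {S : Set (X → ℝ)} (hS : S.Countable) (hSU : S ⊆ USC X)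
    (hlim : ∀ D : Set X, IsClosed D →
      ∃ g : ℕ → X → ℝ, (∀ n, g n ∈ S) ∧ PointwiseLimit g (D.indicator 1)) :
    PropertyU X := by
  have : Countable S := hS
  have hz : ∀ s : S, IsZeroSet {x | (1 / 2 : ℝ) ≤ s.1 x} := fun s => by
    refine IsClosed.isZeroSet ?_
    simpa [compl_ofPred] using (hSU s.2 (1 / 2)).isClosed_compl
  choose k hkc hk using hz
  let F : X → S → ℝ := fun x s => k s x
  have hF : Continuous F := continuous_pi fun s => hkc s
  have hmem : ∀ (s : S) x, 1 / 2 ≤ s.1 x ↔ F x s = 0 := fun s x => by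
    have := congrArg (x ∈ ·) (hk s)
    simpa using this
  have hD : ∀ D : Set X, IsClosed D → ∃ g : ℕ → S, ∀ x, x ∈ D ↔
      ∃ N, ∀ n, N ≤ n → F x (g n) = 0 := by
    intro D hD
    obtain ⟨g, hg, hgl⟩ := hlim D hD
    refine ⟨fun n => ⟨g n, hg n⟩, fun x => ?_⟩
    simp only [← hmem]
    constructor
    · intro hx
      have := hgl x
      rw [indicator_of_mem hx] at this
      exact eventually_atTop.1 (this.eventually_const_le (by norm_num))
    · intro h
      by_contra hx
      have := ge_of_tendsto (hgl x) (eventually_atTop.2 h)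
      rw [indicator_of_notMem hx] at this
      norm_num at this
  have hinj : Function.Injective F := by
    intro x y hxy
    obtain ⟨g, hg⟩ := hD {y} isClosed_singleton
    have := (hg y).1 rfl
    rw [← hxy] at this
    exact (hg x).2 this
  refine ⟨range F, inferInstance, inferInstance, inferInstance, rangeFactorization F,
    hF.subtype_mk _, ⟨fun x y h => hinj (congrArg Subtype.val h), rangeFactorization_surjective⟩,
    ?_⟩
  rintro _ ⟨u, hu, rfl⟩
  obtain ⟨g, hg⟩ := hD _ (isClosed_singleton.preimage hu)
  refine ⟨fun N => {y | ∀ n, N ≤ n → y.1 (g n) = 0}, fun N => ?_, ?_⟩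
  · simp only [ofPred_forall]
    exact isClosed_iInter fun n => isClosed_iInter fun _ =>
      isClosed_eq ((continuous_apply _).comp continuous_subtype_val) continuous_const
  · ext ⟨_, x, rfl⟩
    have : (⟨F x, x, rfl⟩ : range F) ∈ rangeFactorization F '' (u ⁻¹' {0}) ↔ x ∈ u ⁻¹' {0} := by
      constructor
      · rintro ⟨z, hz, hzx⟩
        rwa [← hinj (congrArg Subtype.val hzx)]
      · exact fun hx => ⟨x, hx, rfl⟩
    rw [this, hg x]
    simp

theorem USC.fSigmaMeasurable {X : Type u} [TopologicalSpace X] [PerfectlyNormalSpace X]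
    {φ : X → ℝ} (hφ : φ ∈ USC X) : FSigmaMeasurable φ := by
  refine fun r => ⟨(hφ r).isFSigmaSet, ?_⟩
  have : {x | r < φ x} = ⋃ n : ℕ, {x | φ x < r + 1 / ((n : ℝ) + 1)}ᶜ := by
    ext x
    simp only [mem_ofPred_eq, mem_iUnion, mem_compl_iff, not_lt]
    constructor
    · intro hx
      obtain ⟨n, hn⟩ := exists_nat_one_div_lt (sub_pos.2 hx)
      exact ⟨n, by linarith⟩
    · rintro ⟨n, hn⟩
      have : (0 : ℝ) < 1 / ((n : ℝ) + 1) := Nat.one_div_pos_of_nat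
      linarith
  rw [this]
  exact .iUnion fun n => (hφ _).isClosed_compl.isFSigmaSet

theorem IsClosed.indicator_mem_USC {X : Type u} [TopologicalSpace X] {D : Set X}
    (hD : IsClosed D) : D.indicator 1 ∈ USC X :=
  upperSemicontinuous_iff_isOpen_preimage.1 (hD.upperSemicontinuous_indicator zero_le_one)

theorem IsClosed.indicator_mem_B1 {X : Type u} [TopologicalSpace X] [PerfectlyNormalSpace X]
    {D : Set X} (hD : IsClosed D) : D.indicator 1 ∈ B1 X := by
  obtain ⟨g, hg, rfl⟩ := hD.isZeroSet
  refine ⟨fun n x => max 0 (1 - n * |g x|), fun n => by fun_prop, fun x => ?_⟩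
  by_cases hx : g x = 0
  · simp [hx]
  · rw [indicator_of_notMem (by simpa using hx)]
    refine tendsto_const_nhds.congr' ?_
    have := (tendsto_natCast_atTop_atTop (R := ℝ)).atTop_mul_const (abs_pos.2 hx)
    filter_upwards [this.eventually_ge_atTop 1] with n hn
    exact (max_eq_left (by linarith)).symm

/-- For a perfectly normal Tychonoff space `X`, sequential separability of `USC_p(X)`,
property `U`, and the existence of a countable `S ⊆ C(X)` with `[S]_seq = B₁(X)` are
all equivalent. -/
theorem stmt6 (X : Type u) [TopologicalSpace X] [T2Space X] [CompletelyRegularSpace X]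
    [PerfectlyNormalSpace X] :
    (SeqSeparable (USC X) ↔ PropertyU X) ∧
    (PropertyU X ↔ ∃ S : Set (X → ℝ), S.Countable ∧ (∀ f ∈ S, Continuous f) ∧
      ∀ f ∈ B1 X, ∃ g : ℕ → X → ℝ, (∀ n, g n ∈ S) ∧ PointwiseLimit g f) := by
  refine ⟨⟨?_, fun hX => ?_⟩, ⟨fun hX => ?_, ?_⟩⟩
  · rintro ⟨S, hSU, hS, hlim⟩
    exact propertyU_of_indicator_limits hS hSU fun D hD => hlim _ hD.indicator_mem_USC
  · obtain ⟨S, hS, hSc, hlim⟩ := hX.exists_countable_continuous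
    exact ⟨S, fun g hg => (hSc g hg).mem_USC, hS, fun φ hφ => hlim φ (USC.fSigmaMeasurable hφ)⟩
  · obtain ⟨S, hS, hSc, hlim⟩ := hX.exists_countable_continuous
    refine ⟨S, hS, hSc, fun φ hφ => ?_⟩
    obtain ⟨g, hg, hgφ⟩ := hφ
    exact hlim φ (fSigmaMeasurable_of_pointwiseLimit hg hgφ)
  · rintro ⟨S, hS, hSc, hlim⟩
    exact propertyU_of_indicator_limits hS (fun g hg => (hSc g hg).mem_USC)
      fun D hD => hlim _ hD.indicator_mem_B1
end
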